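/- arXiv:2601.02193 — 2 statements merged into one kernel-verified Lean document; each statement's English description precedes it below -/
import Mathlib

section
/- There exist constants c, c' > 0 such that for all integers d ≥ 1 and n ≥ c·d the following holds. Set r = ⌈c·n/log(n/d)⌉, let X be the disjoint union of {x_1,…,x_r}, {y_T : T ⊆ {1,…,r}, |T| = d}, and {z_1,…,z_1000}. Let H consist of the all-zero function h⋆ together with, for each d-element subset T of {1,…,r} and each j ∈ {1,…,1000}, the function h_{T,j} given by: h_{T,j}(x_i) = 1 iff i ∈ T; h_{T,j}(y_{T'}) = 1 iff T' ≠ T; h_{T,j}(z_{j'}) = 1 iff j' = j. Let D be uniform on {x_1,…,x_r}. Let E_rand be the randomized ERM that, on a labeled sample S, outputs a uniformly random element of {h ∈ H : h agrees with the labels of all points of S}. Define the monotone adversary A: given a clean sample C ∈ X^n, if there is a d-element subset T of {1,…,r} with x_i ∉ C for all i ∈ T, output m copies of y_T for the lexicographically smallest such T; otherwise output m copies of x_1. Let t ≥ 1, m = ⌈2n/t⌉, k ≥ 1, and let L_1,…,L_k be arbitrary fixed sequences of indices from {1,…,n+m}, each containing at least t distinct indices. Draw C ∼ D^n, let S be a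 uniformly random permutation of the n + m points of C and A(C), all labeled by h⋆, let S_i be the labeled subsequence of S given by the indices in L_i, draw h_i = E_rand(S_i) independently, and define h_vote(x) = 1 iff |{i : h_i(x) = 1}| > k/2. Then E[ err_{D,h⋆}(h_vote) ] ≥ d·log(n/d)/(c'·n). -/
open Classical

noncomputable section

/-- The domain: the disjoint union of `{x_1,…,x_r}` (encoded `Sum.inl i`),
`{y_T : T ⊆ {1,…,r}, |T| = d}` (encoded `Sum.inr (Sum.inl T)`) and `{z_1,…,z_1000}`
(encoded `Sum.inr (Sum.inr j)`). -/
abbrev Dom (r d : ℕ) := Fin r ⊕ ({T : Finset (Fin r) // T.card = d} ⊕ Fin 1000)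

/-- The hypothesis `h_{T,j}`: `h_{T,j}(x_i) = 1` iff `i ∈ T`; `h_{T,j}(y_{T'}) = 1` iff
`T' ≠ T`; `h_{T,j}(z_{j'}) = 1` iff `j' = j`. -/
def hypTj {r d : ℕ} (T : {T : Finset (Fin r) // T.card = d}) (j : Fin 1000) :
    Dom r d → Bool
  | Sum.inl i => decide (i ∈ T.1)
  | Sum.inr (Sum.inl T') => decide (T' ≠ T)
  | Sum.inr (Sum.inr j') => decide (j' = j)

/-- The class `H` as a finite set: the all-zero target `h⋆` together with all the
`h_{T,j}`. -/
def Hfin (r d : ℕ) : Finset (Dom r d → Bool) :=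
  insert (fun _ => false)
    (Finset.image (fun p : {T : Finset (Fin r) // T.card = d} × Fin 1000 =>
      hypTj p.1 p.2) Finset.univ)

/-- The hypotheses of `H` consistent with a labeled sample `S`. -/
def consis {r d : ℕ} (S : List (Dom r d × Bool)) : Finset (Dom r d → Bool) :=
  @Finset.filter _ (fun h => ∀ p ∈ S, h p.1 = p.2)
    (fun h => List.decidableBAll _ S) (Hfin r d)

/-- The probability that the random ERM `E_rand` (a uniformly random consistent
hypothesis of `H`) on sample `S` returns `h`. -/
def wRand {r d : ℕ} (S : List (Dom r d × Bool)) (h : Dom r d → Bool) : ℝ :=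
  if h ∈ consis S then 1 / ((consis S).card : ℝ) else 0

/-- The candidate sets for the adversary: `d`-element subsets `T` of `{1,…,r}` with
`x_i ∉ C` for all `i ∈ T`. -/
def cands {r d n : ℕ} (C : Fin n → Fin r) : Finset {T : Finset (Fin r) // T.card = d} :=
  Finset.univ.filter fun T => ∀ i ∈ T.1, ∀ j, C j ≠ i

/-- Encoding of a `d`-subset of `{1,…,r}` as a natural number; among subsets this
encoding is strictly antitone with respect to the lexicographic order, so the
lexicographically smallest candidate set is the one maximizing `encT`. -/
def encT {r d : ℕ} (T : {T : Finset (Fin r) // T.card = d}) : ℕ :=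
  ∑ i ∈ T.1, 2 ^ (r - 1 - (i : ℕ))

/-- The single point the monotone adversary adds (`m` copies of it): `y_T` for the
lexicographically smallest candidate `T` if one exists, and `x_1` otherwise. -/
def advPoint {r d n : ℕ} (hr : 0 < r) (C : Fin n → Fin r) : Dom r d :=
  if h : (cands (d := d) C).Nonempty then
    Sum.inr (Sum.inl (((cands (d := d) C).exists_max_image encT h).choose))
  else Sum.inl ⟨0, hr⟩

/-- The shuffled labeled sample of size `n + m`: the `n` clean points `x_{C j}` and `m`
copies of the adversarial point, permuted by `π` and all labeled `0` by the target. -/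
def sample {r d n m : ℕ} (hr : 0 < r) (C : Fin n → Fin r)
    (π : Equiv.Perm (Fin (n + m))) (j : Fin (n + m)) : Dom r d × Bool :=
  (Fin.append (fun a => Sum.inl (C a)) (fun _ => advPoint (d := d) hr C) (π j), false)

/-- The majority vote of the hypotheses `hs 1, …, hs k`. -/
def vote {r d k : ℕ} (hs : Fin k → (Dom r d → Bool)) : Dom r d → Bool :=
  fun x => decide (k < 2 * (Finset.univ.filter fun i : Fin k => hs i x = true).card)

/-- A uniformly random permutation of `Fin N` maps `J` into `A` with probability at most
`(|A| / N) ^ |J|`. -/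
lemma card_perm_mapsTo_le {N n : ℕ} (A : Finset (Fin N)) (hA : A.card = n)
    (J : Finset (Fin N)) :
    (N : ℝ) ^ J.card *
        ((Finset.univ.filter fun π : Equiv.Perm (Fin N) => ∀ j ∈ J, π j ∈ A).card : ℝ) ≤
      (n : ℝ) ^ J.card * (Nat.factorial N : ℝ) := by
  induction J using Finset.induction_on with
  | empty => simp [Fintype.card_perm]
  | insert a J ha ih =>
    set P : Finset (Equiv.Perm (Fin N)) := Finset.univ.filter fun π => ∀ j ∈ J, π j ∈ A with hP
    set Q : Finset (Equiv.Perm (Fin N)) :=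
      Finset.univ.filter fun π => ∀ j ∈ insert a J, π j ∈ A with hQ
    have hsymm : ∀ b ∈ Jᶜ, (P.filter fun π => π b ∈ A).card = Q.card := by
      intro b hb
      have hb' : b ∉ J := by simpa using hb
      have hswap : ∀ j ∈ J, Equiv.swap a b j = j := fun j hj =>
        Equiv.swap_apply_of_ne_of_ne (fun h => ha (h ▸ hj)) (fun h => hb' (h ▸ hj))
      refine Finset.card_nbij' (fun π => π * Equiv.swap a b) (fun π => π * Equiv.swap a b)
        ?_ ?_ ?_ ?_
      · intro π hπ
        simp only [hP, hQ, Finset.coe_filter, Finset.mem_filter, Finset.mem_univ, true_and,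
          Set.mem_ofPred_eq, Finset.mem_insert, forall_eq_or_imp, Equiv.Perm.mul_apply,
          Equiv.swap_apply_left] at hπ ⊢
        exact ⟨hπ.2, fun j hj => by rw [hswap j hj]; exact hπ.1 j hj⟩
      · intro π hπ
        simp only [hP, hQ, Finset.coe_filter, Finset.mem_filter, Finset.mem_univ, true_and,
          Set.mem_ofPred_eq, Finset.mem_insert, forall_eq_or_imp, Equiv.Perm.mul_apply,
          Equiv.swap_apply_right] at hπ ⊢
        exact ⟨fun j hj => by rw [hswap j hj]; exact hπ.2 j hj, hπ.1⟩
      · intro π _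
        simp [mul_assoc]
      · intro π _
        simp [mul_assoc]
    have hcount : ∀ π ∈ P, (Jᶜ.filter fun b => π b ∈ A).card = n - J.card := by
      intro π hπ
      have hπ' : ∀ j ∈ J, π j ∈ A := by simpa [hP] using hπ
      have h1 : (Jᶜ.filter fun b => π b ∈ A) = A.map π.symm.toEmbedding \ J := by
        ext b
        simp [Finset.mem_map_equiv, and_comm]
      rw [h1, Finset.card_sdiff_of_subset, Finset.card_map, hA]
      intro j hj
      simpa [Finset.mem_map_equiv] using hπ' j hj
    have hle : P.Nonempty → J.card ≤ n := by
      rintro ⟨π, hπ⟩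
      have hπ' : ∀ j ∈ J, π j ∈ A := by simpa [hP] using hπ
      rw [← hA]
      exact Finset.card_le_card_of_injOn π hπ' π.injective.injOn
    have hdouble : (N - J.card) * Q.card = (n - J.card) * P.card := by
      have h1 : ∑ b ∈ Jᶜ, (P.filter fun π => π b ∈ A).card
          = ∑ π ∈ P, (Jᶜ.filter fun b => π b ∈ A).card := by
        simp only [Finset.card_filter]
        exact Finset.sum_comm
      rw [Finset.sum_congr rfl hsymm, Finset.sum_congr rfl hcount] at h1
      simpa [Finset.card_compl, mul_comm] using h1
    have hJN : J.card < N := by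
      have : J.card < (Finset.univ : Finset (Fin N)).card :=
        Finset.card_lt_card (Finset.ssubset_univ_iff.2 fun h => ha (h ▸ Finset.mem_univ a))
      simpa using this
    have hnN : n ≤ N := by
      rw [← hA]; simpa using Finset.card_le_univ A
    have hstep : (N : ℝ) * Q.card ≤ n * P.card := by
      rcases P.eq_empty_or_nonempty with h0 | hne
      · have : Q.card = 0 := by
          have h2 : (N - J.card) * Q.card = 0 := by rw [hdouble, h0]; simp
          rcases Nat.mul_eq_zero.1 h2 with h | h
          · omega
          · exact h
        simp [this]
        positivity
      · have hJn := hle hne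
        have hd : ((N : ℝ) - J.card) * Q.card = (n - J.card) * P.card := by
          have := congrArg (Nat.cast (R := ℝ)) hdouble
          push_cast [Nat.cast_sub hJN.le, Nat.cast_sub hJn] at this
          exact this
        have hpos : (0 : ℝ) < N - J.card := by
          have : (J.card : ℝ) < N := by exact_mod_cast hJN
          linarith
        have hnN' : (0 : ℝ) ≤ (N : ℝ) - n := by
          have : (n : ℝ) ≤ N := by exact_mod_cast hnN
          linarith
        have hk : ((N : ℝ) - J.card) * (n * P.card - N * Q.card)
            = J.card * ((N - n) * P.card) := by
          linear_combination (-(N : ℝ)) * hd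
        have : 0 ≤ (n : ℝ) * P.card - N * Q.card := by
          refine nonneg_of_mul_nonneg_right ?_ hpos
          rw [hk]; positivity
        linarith
    rw [Finset.card_insert_of_notMem ha, pow_succ, pow_succ]
    calc (N : ℝ) ^ J.card * N * Q.card = (N : ℝ) ^ J.card * (N * Q.card) := by ring
      _ ≤ (N : ℝ) ^ J.card * (n * P.card) := by gcongr
      _ = n * ((N : ℝ) ^ J.card * P.card) := by ring
      _ ≤ n * ((n : ℝ) ^ J.card * Nat.factorial N) := by gcongr
      _ = (n : ℝ) ^ J.card * n * Nat.factorial N := by ring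

/-- If `m ≥ 2n/t`, at most a third of all permutations map a given set of at least `t` elements
into the first block of `Fin (n + m)`. -/
lemma card_perm_mapsTo_castAdd_le {n m t : ℕ} (hn : 0 < n) (ht : 1 ≤ t)
    (hm : 2 * (n : ℝ) / t ≤ m) (J : Finset (Fin (n + m))) (hJ : t ≤ J.card) :
    ((Finset.univ.filter fun π : Equiv.Perm (Fin (n + m)) =>
        ∀ j ∈ J, ((π j : Fin (n + m)) : ℕ) < n).card : ℝ) ≤ (Nat.factorial (n + m) : ℝ) / 3 := by
  have hA : (Finset.univ.filter fun a : Fin (n + m) => (a : ℕ) < n).card = n := by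
    have : (Finset.univ.filter fun a : Fin (n + m) => (a : ℕ) < n)
        = Finset.univ.map (Fin.castAddEmb m : Fin n ↪ Fin (n + m)) := by
      ext a
      simp only [Finset.mem_filter, Finset.mem_univ, true_and, Finset.mem_map,
        Fin.castAddEmb_apply]
      constructor
      · exact fun h => ⟨⟨a, h⟩, rfl⟩
      · rintro ⟨b, rfl⟩
        exact b.2
    rw [this]; simp
  have h := card_perm_mapsTo_le _ hA J
  simp only [Finset.mem_filter, Finset.mem_univ, true_and] at h
  set q : ℝ := ((Finset.univ.filter fun π : Equiv.Perm (Fin (n + m)) =>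
        ∀ j ∈ J, ((π j : Fin (n + m)) : ℕ) < n).card : ℝ)
  have hn' : (0 : ℝ) < n := by exact_mod_cast hn
  have ht' : (0 : ℝ) < t := by exact_mod_cast ht
  have hratio : 1 + 2 / (t : ℝ) ≤ ((n + m : ℕ) : ℝ) / n := by
    rw [le_div_iff₀ hn']
    push_cast
    have : (1 + 2 / (t : ℝ)) * n = n + 2 * n / t := by ring
    linarith
  have hone : 1 ≤ 1 + 2 / (t : ℝ) := by
    have : 0 ≤ 2 / (t : ℝ) := by positivity
    linarith
  have h3 : (3 : ℝ) ≤ (((n + m : ℕ) : ℝ) / n) ^ J.card :=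
    calc (3 : ℝ) = 1 + t * (2 / (t : ℝ)) := by field_simp; norm_num
      _ ≤ (1 + 2 / (t : ℝ)) ^ t :=
        one_add_mul_le_pow (by have : 0 ≤ 2 / (t : ℝ) := by positivity
                               linarith) t
      _ ≤ (1 + 2 / (t : ℝ)) ^ J.card := pow_le_pow_right₀ hone hJ
      _ ≤ _ := by gcongr
  have hpos : (0 : ℝ) < (n : ℝ) ^ J.card := by positivity
  rw [div_pow, le_div_iff₀ hpos] at h3
  have hq : 0 ≤ q := Nat.cast_nonneg _
  have : (n : ℝ) ^ J.card * (3 * q) ≤ (n : ℝ) ^ J.card * Nat.factorial (n + m) := by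
    nlinarith
  have := le_of_mul_le_mul_left this hpos
  linarith

/-- Under a product of probability weights, the expectation of a function of one coordinate is
its expectation under the corresponding marginal. -/
lemma sum_prod_mul_apply {ι α : Type*} [Fintype ι] [DecidableEq ι] [Fintype α] (w : ι → α → ℝ)
    (hw : ∀ i, ∑ a, w i a = 1) (f : α → ℝ) (i : ι) :
    ∑ x : ι → α, (∏ j, w j (x j)) * f (x i) = ∑ a, w i a * f a := by
  have h1 : ∀ x : ι → α, (∏ j, w j (x j)) * f (x i)
      = ∏ j, w j (x j) * (if j = i then f (x j) else 1) := by
    intro x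
    rw [Finset.prod_mul_distrib]
    simp
  simp_rw [h1]
  rw [← Fintype.piFinset_univ,
    ← Finset.prod_univ_sum (fun _ : ι => (Finset.univ : Finset α))
      (fun j a => w j a * (if j = i then f a else 1)),
    Finset.prod_eq_single i]
  · simp
  · intro j _ hj
    simp [hj, hw]
  · simp

lemma sum_prod_eq_one {ι α : Type*} [Fintype ι] [DecidableEq ι] [Fintype α] (w : ι → α → ℝ)
    (hw : ∀ i, ∑ a, w i a = 1) : ∑ x : ι → α, ∏ j, w j (x j) = 1 := by
  rw [← Fintype.piFinset_univ,
    ← Finset.prod_univ_sum (fun _ : ι => (Finset.univ : Finset α)) w]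
  simp [hw]

lemma wRand_nonneg {r d : ℕ} (S : List (Dom r d × Bool)) (h : Dom r d → Bool) :
    0 ≤ wRand S h := by
  unfold wRand
  split_ifs <;> positivity

lemma mem_consis {r d : ℕ} {S : List (Dom r d × Bool)} {h : Dom r d → Bool} :
    h ∈ consis S ↔ h ∈ Hfin r d ∧ ∀ p ∈ S, h p.1 = p.2 := by
  simp [consis]

lemma zero_mem_consis {r d : ℕ} {S : List (Dom r d × Bool)} (hS : ∀ p ∈ S, p.2 = false) :
    (fun _ => false) ∈ consis S :=
  mem_consis.2 ⟨Finset.mem_insert_self _ _, fun p hp => (hS p hp).symm⟩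

lemma sum_wRand {r d : ℕ} {S : List (Dom r d × Bool)} (hS : ∀ p ∈ S, p.2 = false) :
    ∑ h, wRand S h = 1 := by
  have hpos : 0 < (consis S).card := Finset.card_pos.2 ⟨_, zero_mem_consis hS⟩
  simp only [wRand]
  rw [Finset.sum_ite_mem, Finset.univ_inter, Finset.sum_const, nsmul_eq_mul]
  field_simp

/-- A sample consistent with the all-zero target and with every `h_{T,j}`, and containing `y_T`,
leaves the random ERM only a `1/1001` chance of not classifying all of `T` as `1`. -/
lemma sum_wRand_not_all_true_le {r d : ℕ} {S : List (Dom r d × Bool)}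
    (hS : ∀ p ∈ S, p.2 = false) (T : {T : Finset (Fin r) // T.card = d})
    (hT : ∀ j, ∀ p ∈ S, hypTj T j p.1 = false) (hy : (Sum.inr (Sum.inl T), false) ∈ S) :
    ∑ h, wRand S h * (if ∀ i ∈ T.1, h (Sum.inl i) = true then 0 else 1) ≤ 1 / 1001 := by
  have hinj : Function.Injective (hypTj (r := r) (d := d) T) := by
    intro j j' h
    have := congrFun h (Sum.inr (Sum.inr j))
    simpa [hypTj] using this
  have hzero : (fun _ => false) ∉ Finset.univ.image (hypTj (r := r) (d := d) T) := by
    simp only [Finset.mem_image, Finset.mem_univ, true_and, not_exists]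
    intro j h
    have := congrFun h (Sum.inr (Sum.inr j))
    simp [hypTj] at this
  have hsub : insert (fun _ => false) (Finset.univ.image (hypTj (r := r) (d := d) T))
      ⊆ consis S := by
    intro h hh
    rcases Finset.mem_insert.1 hh with rfl | hh
    · exact zero_mem_consis hS
    · obtain ⟨j, -, rfl⟩ := Finset.mem_image.1 hh
      refine mem_consis.2 ⟨Finset.mem_insert_of_mem
        (Finset.mem_image.2 ⟨(T, j), Finset.mem_univ _, rfl⟩), fun p hp => ?_⟩
      rw [hT j p hp, hS p hp]
  have hcard : 1001 ≤ (consis S).card := by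
    have := Finset.card_le_card hsub
    rw [Finset.card_insert_of_notMem hzero, Finset.card_image_of_injective _ hinj] at this
    simpa using this
  have hcard' : (1001 : ℝ) ≤ (consis S).card := by exact_mod_cast hcard
  have hle : ∀ h, wRand S h * (if ∀ i ∈ T.1, h (Sum.inl i) = true then 0 else 1)
      ≤ if h = (fun _ => false) then (1 : ℝ) / 1001 else 0 := by
    intro h
    by_cases h0 : h = fun _ => false
    · rw [if_pos h0]
      have hw : wRand S h ≤ 1 / 1001 := by
        unfold wRand
        split_ifs
        · exact one_div_le_one_div_of_le (by norm_num) hcard'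
        · norm_num
      split_ifs
      · norm_num
      · simpa using hw
    · rw [if_neg h0]
      by_cases hc : h ∈ consis S
      · obtain ⟨hH, hcons⟩ := mem_consis.1 hc
        rcases Finset.mem_insert.1 hH with h1 | h1
        · exact absurd h1 h0
        · obtain ⟨⟨T', j⟩, -, rfl⟩ := Finset.mem_image.1 h1
          have hTT : T = T' := by simpa [hypTj] using hcons _ hy
          subst hTT
          rw [if_pos (fun i hi => by simpa [hypTj] using hi), mul_zero]
      · simp [wRand, hc]
  calc _ ≤ ∑ h, if h = (fun _ => false) then (1 : ℝ) / 1001 else 0 :=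
        Finset.sum_le_sum fun h _ => hle h
    _ = 1 / 1001 := by simp

/-- The majority vote errs on all of `T` unless at least half of the voters miss part of `T`. -/
lemma card_vote_ge {r d k : ℕ} (hk : 1 ≤ k) (T : {T : Finset (Fin r) // T.card = d})
    (hs : Fin k → (Dom r d → Bool)) :
    (d : ℝ) * (1 - 2 / k * ∑ i, (if ∀ a ∈ T.1, hs i (Sum.inl a) = true then 0 else 1)) ≤
      ((Finset.univ.filter fun i : Fin r => vote hs (Sum.inl i) = true).card : ℝ) := by
  have hk' : (0 : ℝ) < k := by exact_mod_cast hk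
  set G := Finset.univ.filter fun i : Fin k => ∀ a ∈ T.1, hs i (Sum.inl a) = true with hG
  have hsum : (∑ i : Fin k, (if ∀ a ∈ T.1, hs i (Sum.inl a) = true then (0 : ℝ) else 1))
      = k - G.card := by
    have h1 : ∀ i : Fin k, (if ∀ a ∈ T.1, hs i (Sum.inl a) = true then (0 : ℝ) else 1)
        = 1 - (if ∀ a ∈ T.1, hs i (Sum.inl a) = true then (1 : ℝ) else 0) := by
      intro i; split_ifs <;> norm_num
    simp_rw [h1]
    rw [Finset.sum_sub_distrib, Finset.sum_boole]
    simp [hG]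
  rw [hsum]
  by_cases hmaj : k < 2 * G.card
  · have hsub : T.1 ⊆ Finset.univ.filter fun i : Fin r => vote hs (Sum.inl i) = true := by
      intro a ha
      simp only [Finset.mem_filter, Finset.mem_univ, true_and, vote, decide_eq_true_eq]
      refine hmaj.trans_le (Nat.mul_le_mul_left 2 (Finset.card_le_card ?_))
      intro i hi
      simp only [hG, Finset.mem_filter, Finset.mem_univ, true_and] at hi ⊢
      exact hi a ha
    have h1 := Finset.card_le_card hsub
    rw [T.2] at h1
    have h2 : (d : ℝ) ≤ ((Finset.univ.filter fun i : Fin r =>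
      vote hs (Sum.inl i) = true).card : ℝ) := by exact_mod_cast h1
    refine le_trans ?_ h2
    have hGk : (G.card : ℝ) ≤ k := by
      have : G.card ≤ k := by simpa using Finset.card_le_univ G
      exact_mod_cast this
    have : 0 ≤ 2 / (k : ℝ) * (k - G.card) := mul_nonneg (by positivity) (by linarith)
    have hd : (0 : ℝ) ≤ d := Nat.cast_nonneg d
    nlinarith
  · have hm : 2 * (G.card : ℝ) ≤ k := by
      have : 2 * G.card ≤ k := by omega
      exact_mod_cast this
    have h1 : 1 ≤ 2 / (k : ℝ) * (k - G.card) := by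
      rw [div_mul_eq_mul_div, le_div_iff₀ hk']
      linarith
    have hd : (0 : ℝ) ≤ d := Nat.cast_nonneg d
    refine le_trans ?_ (Nat.cast_nonneg _)
    nlinarith

lemma exists_advPoint_eq {r d n : ℕ} (hr : 0 < r) (C : Fin n → Fin r)
    (h : (cands (d := d) C).Nonempty) :
    ∃ T : {T : Finset (Fin r) // T.card = d}, T ∈ cands C ∧
      advPoint (d := d) hr C = Sum.inr (Sum.inl T) := by
  refine ⟨((cands (d := d) C).exists_max_image encT h).choose,
    ((cands (d := d) C).exists_max_image encT h).choose_spec.1, ?_⟩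
  rw [advPoint, dif_pos h]

lemma expected_errors_nonneg {r d n m k : ℕ} (hr : 0 < r) (L : Fin k → List (Fin (n + m)))
    (C : Fin n → Fin r) :
    0 ≤ ∑ π : Equiv.Perm (Fin (n + m)), ∑ hs : Fin k → (Dom r d → Bool),
      (∏ i : Fin k, wRand ((L i).map (sample (d := d) hr C π)) (hs i)) *
        (((Finset.univ.filter fun i : Fin r =>
          vote hs (Sum.inl i) = true).card : ℝ) / (r : ℝ)) :=
  Finset.sum_nonneg fun _ _ => Finset.sum_nonneg fun _ _ =>
    mul_nonneg (Finset.prod_nonneg fun _ _ => wRand_nonneg _ _) (by positivity)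

/-- Conditioned on a clean sample missing at least `d` points, the expected error of the vote is
at least `d / (4 r)`. -/
lemma expected_errors_ge {r d n m t k : ℕ} (hr : 0 < r) (hn : 0 < n) (ht : 1 ≤ t) (hk : 1 ≤ k)
    (hm : 2 * (n : ℝ) / t ≤ m) (L : Fin k → List (Fin (n + m)))
    (hL : ∀ i, t ≤ (L i).toFinset.card) (C : Fin n → Fin r)
    (hC : (cands (d := d) C).Nonempty) :
    (d : ℝ) / r * (Nat.factorial (n + m) : ℝ) / 4 ≤
      ∑ π : Equiv.Perm (Fin (n + m)), ∑ hs : Fin k → (Dom r d → Bool),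
        (∏ i : Fin k, wRand ((L i).map (sample (d := d) hr C π)) (hs i)) *
          (((Finset.univ.filter fun i : Fin r =>
            vote hs (Sum.inl i) = true).card : ℝ) / (r : ℝ)) := by
  obtain ⟨T, hTC, hadv⟩ := exists_advPoint_eq (d := d) hr C hC
  have hTC' : ∀ i ∈ T.1, ∀ j, C j ≠ i := by simpa [cands] using hTC
  have hk' : (0 : ℝ) < k := by exact_mod_cast hk
  have hr' : (0 : ℝ) < r := by exact_mod_cast hr
  have hfalse : ∀ (π : Equiv.Perm (Fin (n + m))) (i : Fin k),
      ∀ p ∈ (L i).map (sample (d := d) hr C π), p.2 = false := by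
    intro π i p hp
    obtain ⟨j, -, rfl⟩ := List.mem_map.1 hp
    rfl
  have hcons : ∀ (π : Equiv.Perm (Fin (n + m))) (i : Fin k) (l : Fin 1000),
      ∀ p ∈ (L i).map (sample (d := d) hr C π), hypTj T l p.1 = false := by
    intro π i l p hp
    obtain ⟨j, -, rfl⟩ := List.mem_map.1 hp
    simp only [sample]
    refine Fin.addCases (fun a => ?_) (fun b => ?_) (π j)
    · have : C a ∉ T.1 := fun h => hTC' _ h a rfl
      simpa [Fin.append_left, hypTj] using this
    · simp [Fin.append_right, hadv, hypTj]
  let w : Equiv.Perm (Fin (n + m)) → Fin k → (Dom r d → Bool) → ℝ :=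
    fun π i => wRand ((L i).map (sample (d := d) hr C π))
  let f : (Dom r d → Bool) → ℝ :=
    fun h => if ∀ a ∈ T.1, h (Sum.inl a) = true then 0 else 1
  have hw : ∀ π i, ∑ h, w π i h = 1 := fun π i => sum_wRand (hfalse π i)
  have hmarg : ∀ π i, ∑ h, w π i h * f h ≤
      1 / 1001 + if ∀ j ∈ (L i).toFinset, ((π j : Fin (n + m)) : ℕ) < n then (1 : ℝ) else 0 := by
    intro π i
    by_cases hmiss : ∀ j ∈ (L i).toFinset, ((π j : Fin (n + m)) : ℕ) < n
    · rw [if_pos hmiss]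
      have : ∑ h, w π i h * f h ≤ ∑ h, w π i h := by
        refine Finset.sum_le_sum fun h _ => mul_le_of_le_one_right (wRand_nonneg _ _) ?_
        simp only [f]
        split_ifs <;> norm_num
      rw [hw] at this
      linarith
    · rw [if_neg hmiss, add_zero]
      push Not at hmiss
      obtain ⟨j, hj, hnj⟩ := hmiss
      refine sum_wRand_not_all_true_le (hfalse π i) T (hcons π i)
        (List.mem_map.2 ⟨j, List.mem_toFinset.1 hj, ?_⟩)
      obtain ⟨b, hb⟩ : ∃ b : Fin m, π j = Fin.natAdd n b :=
        ⟨Fin.subNat n ((π j).cast (Nat.add_comm n m)) hnj, by ext; simp⟩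
      simp only [sample, hb, Fin.append_right, hadv]
  have hinner : ∀ π, (d : ℝ) / r * (1 - 2 / k * ∑ i, ∑ h, w π i h * f h) ≤
      ∑ hs : Fin k → (Dom r d → Bool), (∏ i : Fin k, w π i (hs i)) *
        (((Finset.univ.filter fun i : Fin r =>
          vote hs (Sum.inl i) = true).card : ℝ) / (r : ℝ)) := by
    intro π
    have hexp : ∑ hs : Fin k → (Dom r d → Bool), (∏ i : Fin k, w π i (hs i)) *
        (d * (1 - 2 / k * ∑ i, f (hs i)) / r) =
        (d : ℝ) / r * (1 - 2 / k * ∑ i, ∑ h, w π i h * f h) := by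
      have h1 : ∀ hs : Fin k → (Dom r d → Bool), (∏ i : Fin k, w π i (hs i)) *
          (d * (1 - 2 / k * ∑ i, f (hs i)) / r) =
          (d : ℝ) / r * (∏ i : Fin k, w π i (hs i)) -
            (d : ℝ) / r * (2 / k) * ∑ i, (∏ i : Fin k, w π i (hs i)) * f (hs i) := by
        intro hs
        rw [← Finset.mul_sum]
        ring
      simp_rw [h1]
      rw [Finset.sum_sub_distrib, ← Finset.mul_sum, ← Finset.mul_sum, Finset.sum_comm,
        sum_prod_eq_one _ (hw π)]
      simp_rw [sum_prod_mul_apply _ (hw π) f]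
      ring
    rw [← hexp]
    refine Finset.sum_le_sum fun hs _ =>
      mul_le_mul_of_nonneg_left ?_ (Finset.prod_nonneg fun _ _ => wRand_nonneg _ _)
    exact div_le_div_of_nonneg_right (card_vote_ge hk T hs) hr'.le
  have hswap : ∑ π : Equiv.Perm (Fin (n + m)), ∑ i, ∑ h, w π i h * f h ≤
      k * ((Nat.factorial (n + m) : ℝ) * (1 / 1001 + 1 / 3)) := by
    rw [Finset.sum_comm]
    have : ∀ i ∈ (Finset.univ : Finset (Fin k)),
        ∑ π : Equiv.Perm (Fin (n + m)), ∑ h, w π i h * f h ≤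
          (Nat.factorial (n + m) : ℝ) * (1 / 1001 + 1 / 3) := by
      intro i _
      refine (Finset.sum_le_sum fun π _ => hmarg π i).trans ?_
      rw [Finset.sum_add_distrib, Finset.sum_boole]
      have h1 := card_perm_mapsTo_castAdd_le hn ht hm _ (hL i)
      simp only [Finset.sum_const, Finset.card_univ, Fintype.card_perm, Fintype.card_fin,
        nsmul_eq_mul]
      linarith
    refine (Finset.sum_le_sum this).trans ?_
    simp
  refine le_trans ?_ (Finset.sum_le_sum fun π _ => hinner π)
  rw [← Finset.mul_sum, Finset.sum_sub_distrib, ← Finset.mul_sum, mul_div_assoc]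
  refine mul_le_mul_of_nonneg_left ?_ (by positivity)
  simp only [Finset.sum_const, Finset.card_univ, Fintype.card_perm, Fintype.card_fin,
        nsmul_eq_mul, mul_one]
  have h2 := mul_le_mul_of_nonneg_left hswap (by positivity : 0 ≤ 2 / (k : ℝ))
  have h3 : 2 / (k : ℝ) * (k * ((Nat.factorial (n + m) : ℝ) * (1 / 1001 + 1 / 3)))
      = 2 * (Nat.factorial (n + m) : ℝ) * (1 / 1001 + 1 / 3) := by
    field_simp
  have h4 : (0 : ℝ) ≤ Nat.factorial (n + m) := Nat.cast_nonneg _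
  rw [h3] at h2
  linarith

/-- Chebyshev bound for the number of empty bins when `n` balls are thrown into
`r` bins: at most `4/9` of the assignments leave fewer than `d` bins empty. -/
lemma card_few_missed_le {r n d : ℕ} (hr : 2 ≤ r) (hd : 1 ≤ d)
    (hμ : 4 * (d : ℝ) ≤ r * (1 - 1 / (r : ℝ)) ^ n) :
    ((Finset.univ.filter fun C : Fin n → Fin r =>
      (Finset.univ.filter fun i : Fin r => ∀ j, C j ≠ i).card < d).card : ℝ) ≤
      4 / 9 * (r : ℝ) ^ n := by
  have hr' : (2 : ℝ) ≤ r := by exact_mod_cast hr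
  have hd' : (1 : ℝ) ≤ d := by exact_mod_cast hd
  set μ : ℝ := r * (1 - 1 / (r : ℝ)) ^ n with hμdef
  let miss : (Fin n → Fin r) → Fin r → ℝ := fun C i => if ∀ j, C j ≠ i then 1 else 0
  have hZ : ∀ C, ((Finset.univ.filter fun i : Fin r => ∀ j, C j ≠ i).card : ℝ)
      = ∑ i, miss C i := by
    intro C
    simp only [miss, Finset.sum_boole]
  have hone : ∀ i, ∑ C, miss C i = ((r : ℝ) - 1) ^ n := by
    intro i
    simp only [miss, Finset.sum_boole]
    have : (Finset.univ.filter fun C : Fin n → Fin r => ∀ j, C j ≠ i)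
        = Fintype.piFinset fun _ => Finset.univ.erase i := by
      ext C; simp
    rw [this, Fintype.card_piFinset]
    simp [Finset.card_erase_of_mem, Nat.cast_sub (by omega : 1 ≤ r)]
  have htwo : ∀ i i', i ≠ i' → ∑ C, miss C i * miss C i' = ((r : ℝ) - 2) ^ n := by
    intro i i' hii
    have h1 : ∀ C, miss C i * miss C i' = if ∀ j, C j ≠ i ∧ C j ≠ i' then 1 else 0 := by
      intro C
      simp only [miss, forall_and, ite_and, mul_ite, mul_one, mul_zero]
      split_ifs <;> rfl
    simp_rw [h1, Finset.sum_boole]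
    have : (Finset.univ.filter fun C : Fin n → Fin r => ∀ j, C j ≠ i ∧ C j ≠ i')
        = Fintype.piFinset fun _ => (Finset.univ.erase i).erase i' := by
      ext C; simp [and_comm]
    rw [this, Fintype.card_piFinset]
    have hc : ((Finset.univ.erase i).erase i').card = r - 2 := by
      rw [Finset.card_erase_of_mem (by simp [hii.symm]), Finset.card_erase_of_mem (by simp)]
      simp; omega
    simp [hc, Nat.cast_sub hr]
  have hfirst : ∑ C, ∑ i, miss C i = (r : ℝ) ^ n * μ := by
    rw [Finset.sum_comm]
    simp_rw [hone]
    simp only [Finset.sum_const, Finset.card_univ, Fintype.card_fin, nsmul_eq_mul, hμdef]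
    have : (r : ℝ) - 1 = r * (1 - 1 / r) := by field_simp
    rw [this, mul_pow]; ring
  have hpair : ((r : ℝ) - 2) ^ n ≤ (r : ℝ) ^ n * ((1 - 1 / (r : ℝ)) ^ n) ^ 2 := by
    rw [← pow_mul, mul_comm n 2, pow_mul, ← mul_pow]
    refine pow_le_pow_left₀ (by linarith) ?_ n
    have : (r : ℝ) * (1 - 1 / (r : ℝ)) ^ 2 = r - 2 + 1 / r := by field_simp; ring
    rw [this]
    have : 0 ≤ 1 / (r : ℝ) := by positivity
    linarith
  have hsecond : ∑ C, (∑ i, miss C i) ^ 2 ≤ (r : ℝ) ^ n * (μ + μ ^ 2) := by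
    have h1 : ∀ i i', ∑ C, miss C i * miss C i' ≤
        (if i = i' then ∑ C, miss C i else 0) +
          (r : ℝ) ^ n * ((1 - 1 / (r : ℝ)) ^ n) ^ 2 := by
      intro i i'
      have hq : 0 ≤ (r : ℝ) ^ n * ((1 - 1 / (r : ℝ)) ^ n) ^ 2 := by positivity
      split_ifs with h
      · subst h
        have : ∑ C, miss C i * miss C i = ∑ C, miss C i :=
          Finset.sum_congr rfl fun C _ => by simp only [miss]; split_ifs <;> norm_num
        linarith
      · rw [htwo i i' h]; linarith
    have h2 : ∑ C, (∑ i, miss C i) ^ 2 = ∑ i, ∑ i', ∑ C, miss C i * miss C i' := by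
      simp_rw [sq, Finset.sum_mul_sum]
      rw [Finset.sum_comm]
      exact Finset.sum_congr rfl fun i _ => Finset.sum_comm
    rw [h2]
    refine (Finset.sum_le_sum fun i _ => Finset.sum_le_sum fun i' _ => h1 i i').trans ?_
    simp only [Finset.sum_add_distrib, Finset.sum_ite_eq, Finset.mem_univ, if_true]
    rw [Finset.sum_comm, hfirst]
    simp only [Finset.sum_const, Finset.card_univ, Fintype.card_fin, nsmul_eq_mul, hμdef]
    apply le_of_eq; ring
  have hvar : ∑ C, (∑ i, miss C i - μ) ^ 2 ≤ (r : ℝ) ^ n * μ := by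
    have h1 : ∑ C, (∑ i, miss C i - μ) ^ 2 =
        ∑ C, (∑ i, miss C i) ^ 2 - 2 * μ * ∑ C, ∑ i, miss C i + (r : ℝ) ^ n * μ ^ 2 := by
      have h2 : ∀ C, (∑ i, miss C i - μ) ^ 2 =
          (∑ i, miss C i) ^ 2 - 2 * μ * ∑ i, miss C i + μ ^ 2 := fun C => by ring
      simp_rw [h2]
      rw [Finset.sum_add_distrib, Finset.sum_sub_distrib, ← Finset.mul_sum]
      simp
    rw [h1, hfirst]
    linarith
  set B := Finset.univ.filter fun C : Fin n → Fin r =>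
      (Finset.univ.filter fun i : Fin r => ∀ j, C j ≠ i).card < d with hB
  have hcheb : (B.card : ℝ) * (μ - d) ^ 2 ≤ (r : ℝ) ^ n * μ := by
    refine le_trans ?_ hvar
    rw [← nsmul_eq_mul, ← Finset.sum_const]
    refine (Finset.sum_le_sum fun C hC => ?_).trans
      (Finset.sum_le_sum_of_subset_of_nonneg (Finset.subset_univ B)
        fun _ _ _ => sq_nonneg _)
    have hlt : ((Finset.univ.filter fun i : Fin r => ∀ j, C j ≠ i).card : ℝ) < d := by
      exact_mod_cast (Finset.mem_filter.1 hC).2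
    rw [hZ] at hlt
    nlinarith
  have hμ4 : 4 ≤ μ := by linarith
  have hBnn : (0 : ℝ) ≤ B.card := Nat.cast_nonneg _
  have hlow : 9 / 4 * μ ≤ (μ - d) ^ 2 := by nlinarith
  have : μ * (B.card : ℝ) * (9 / 4) ≤ μ * (r : ℝ) ^ n := by nlinarith
  have : (B.card : ℝ) * (9 / 4) ≤ (r : ℝ) ^ n := by
    refine le_of_mul_le_mul_left ?_ (by linarith : 0 < μ)
    linarith
  linarith

lemma cands_nonempty_of_le {r d n : ℕ} (C : Fin n → Fin r)
    (h : d ≤ (Finset.univ.filter fun i : Fin r => ∀ j, C j ≠ i).card) :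
    (cands (d := d) C).Nonempty := by
  obtain ⟨T, hT, hcard⟩ := Finset.exists_subset_card_eq h
  refine ⟨⟨T, hcard⟩, ?_⟩
  simp only [cands, Finset.mem_filter, Finset.mem_univ, true_and]
  exact fun i hi => (Finset.mem_filter.1 (hT hi)).2

lemma le_card_cands_nonempty {r n d : ℕ} (hr : 2 ≤ r) (hd : 1 ≤ d)
    (hμ : 4 * (d : ℝ) ≤ r * (1 - 1 / (r : ℝ)) ^ n) :
    5 / 9 * (r : ℝ) ^ n ≤
      ((Finset.univ.filter fun C : Fin n → Fin r => (cands (d := d) C).Nonempty).card : ℝ) := by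
  have h1 := card_few_missed_le hr hd hμ
  have h2 : (Finset.univ : Finset (Fin n → Fin r)) ⊆
      (Finset.univ.filter fun C : Fin n → Fin r => (cands (d := d) C).Nonempty) ∪
      (Finset.univ.filter fun C : Fin n → Fin r =>
        (Finset.univ.filter fun i : Fin r => ∀ j, C j ≠ i).card < d) := by
    intro C _
    simp only [Finset.mem_union, Finset.mem_filter, Finset.mem_univ, true_and]
    exact (lt_or_ge _ d).symm.imp_left (cands_nonempty_of_le C)
  have h3 := (Finset.card_le_card h2).trans (Finset.card_union_le _ _)
  rw [Finset.card_univ, Fintype.card_fun, Fintype.card_fin, Fintype.card_fin] at h3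
  have h4 : (r : ℝ) ^ n ≤
      ((Finset.univ.filter fun C : Fin n → Fin r => (cands (d := d) C).Nonempty).card : ℝ) +
      ((Finset.univ.filter fun C : Fin n → Fin r =>
        (Finset.univ.filter fun i : Fin r => ∀ j, C j ≠ i).card < d).card : ℝ) := by
    exact_mod_cast h3
  linarith

lemma exp_neg_two_mul_le_one_sub {x : ℝ} (h0 : 0 ≤ x) (h1 : x ≤ 1 / 2) :
    Real.exp (-(2 * x)) ≤ 1 - x := by
  rw [Real.exp_neg, inv_le_comm₀ (Real.exp_pos _) (by linarith)]
  refine le_trans ?_ (Real.add_one_le_exp _)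
  rw [inv_le_iff_one_le_mul₀ (by linarith)]
  nlinarith

/-- The expected number of missed points is at least `4 d` for `r ≥ 8 n / log (n / d)`. -/
lemma expected_missed_ge {d n r : ℕ} (hd : 1 ≤ d) (hn : 8 * (d : ℝ) ≤ n) (hr2 : 2 ≤ r)
    (hr : 8 * (n : ℝ) / Real.log (n / d) ≤ r) :
    4 * (d : ℝ) ≤ r * (1 - 1 / (r : ℝ)) ^ n := by
  have hd' : (1 : ℝ) ≤ d := by exact_mod_cast hd
  have hr2' : (2 : ℝ) ≤ r := by exact_mod_cast hr2
  have hu : 8 ≤ (n : ℝ) / d := by rwa [le_div_iff₀ (by linarith)]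
  set l := Real.log ((n : ℝ) / d) with hl
  have hlpos : 0 < l := Real.log_pos (by linarith)
  set s := Real.exp (l / 2) with hs
  have hspos : 0 < s := Real.exp_pos _
  have hs2 : s * s = n / d := by
    rw [hs, ← Real.exp_add, add_halves, hl, Real.exp_log (by linarith)]
  have hls : l ≤ 2 * s := by
    have := Real.add_one_le_exp (l / 2)
    linarith
  have hnr : 8 * (n : ℝ) ≤ r * l := by rwa [div_le_iff₀ hlpos] at hr
  have hpow : s⁻¹ ≤ (1 - 1 / (r : ℝ)) ^ n := by
    have h1 : Real.exp (-(2 * (1 / (r : ℝ)))) ≤ 1 - 1 / r :=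
      exp_neg_two_mul_le_one_sub (by positivity)
        (one_div_le_one_div_of_le (by norm_num) hr2')
    refine le_trans ?_ (pow_le_pow_left₀ (Real.exp_pos _).le h1 n)
    rw [← Real.exp_nat_mul, hs, ← Real.exp_neg, Real.exp_le_exp]
    have : (n : ℝ) / r ≤ l / 8 := by
      rw [div_le_iff₀ (by linarith)]
      linarith
    have h2 : (n : ℝ) * -(2 * (1 / (r : ℝ))) = -(2 * ((n : ℝ) / r)) := by ring
    rw [h2]
    linarith
  have hmul : 4 * (d : ℝ) * s ≤ r := by
    have hns : (n : ℝ) = d * (s * s) := by rw [hs2]; field_simp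
    have h1 : 4 * (d : ℝ) * s * l ≤ r * l := by
      refine le_trans ?_ hnr
      rw [hns]
      have : 0 ≤ (d : ℝ) * s := by positivity
      nlinarith
    exact le_of_mul_le_mul_right h1 hlpos
  calc 4 * (d : ℝ) = 4 * d * s * s⁻¹ := by field_simp
    _ ≤ r * s⁻¹ := by gcongr
    _ ≤ _ := by gcongr

/-- majority-voting lower bound for the random consistent-hypothesis ERM
`E_rand`. There are constants `c, c' > 0` such that for all `d ≥ 1`, `n ≥ c·d`,
`t ≥ 1`, `k ≥ 1`, with `r = ⌈c·n/log(n/d)⌉` and `m = ⌈2n/t⌉`, for any fixed lists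
`L_1,…,L_k` of indices in `{1,…,n+m}` each containing at least `t` distinct indices,
the expected error of the majority vote of `h_i = E_rand(S_i)` (drawn independently and
uniformly among the hypotheses of `H` consistent with `S_i`) is at least
`d·log(n/d)/(c'·n)`. The expectation is written as a normalized sum over the clean
sample `C ∼ D^n` (`D` uniform on `{x_1,…,x_r}`) and the uniformly random permutation
`π`, together with the weighted sum over the independent draws `hs` of the `k`
hypotheses. -/
theorem majority_vote_lower_bound_random_erm :
    ∃ c c' : ℝ, 0 < c ∧ 0 < c' ∧
      ∀ d n t k : ℕ, 1 ≤ d → c * (d : ℝ) ≤ (n : ℝ) → 1 ≤ t → 1 ≤ k →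
      ∀ r m : ℕ, r = ⌈c * (n : ℝ) / Real.log ((n : ℝ) / (d : ℝ))⌉₊ →
        m = ⌈2 * (n : ℝ) / (t : ℝ)⌉₊ →
      ∀ hr : 0 < r,
      ∀ L : Fin k → List (Fin (n + m)), (∀ i, t ≤ (L i).toFinset.card) →
      (d : ℝ) * Real.log ((n : ℝ) / (d : ℝ)) / (c' * (n : ℝ)) ≤
        (∑ C : Fin n → Fin r, ∑ π : Equiv.Perm (Fin (n + m)),
          ∑ hs : Fin k → (Dom r d → Bool),
            (∏ i : Fin k, wRand ((L i).map (sample (d := d) hr C π)) (hs i)) *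
              (((Finset.univ.filter fun i : Fin r =>
                  vote hs (Sum.inl i) = true).card : ℝ) / (r : ℝ)))
        / ((r : ℝ) ^ n * (Nat.factorial (n + m) : ℝ)) := by
  refine ⟨8, 100, by norm_num, by norm_num, ?_⟩
  intro d n t k hd hn ht hk r m hrdef hmdef hr L hL
  have hd' : (1 : ℝ) ≤ d := by exact_mod_cast hd
  have hn8 : (8 : ℝ) ≤ n := by linarith
  have hnpos : 0 < n := by
    have : (0 : ℝ) < n := by linarith
    exact_mod_cast this
  have hu : 8 ≤ (n : ℝ) / d := by rwa [le_div_iff₀ (by linarith)]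
  have hun : (n : ℝ) / d ≤ n := div_le_self (by linarith) hd'
  have hrle : 8 * (n : ℝ) / Real.log (n / d) ≤ r := hrdef ▸ Nat.le_ceil _
  have hrlt : (r : ℝ) < 8 * (n : ℝ) / Real.log (n / d) + 1 := by
    rw [hrdef]
    exact Nat.ceil_lt_add_one (div_nonneg (by linarith) (Real.log_nonneg (by linarith)))
  have hlog : Real.log ((n : ℝ) / d) ≤ n :=
    (Real.log_le_sub_one_of_pos (by linarith)).trans (by linarith)
  have hmul : 2 * (n : ℝ) / t ≤ m := hmdef ▸ Nat.le_ceil _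
  have hlpos : 0 < Real.log ((n : ℝ) / d) := Real.log_pos (by linarith)
  have hq : 1 ≤ (n : ℝ) / Real.log (n / d) := by rwa [one_le_div hlpos]
  rw [mul_div_assoc] at hrlt
  have hr2 : 2 ≤ r := by
    have : (2 : ℝ) ≤ r := by
      rw [mul_div_assoc] at hrle
      linarith
    exact_mod_cast this
  have hr' : (0 : ℝ) < r := by exact_mod_cast hr
  have hcard := le_card_cands_nonempty hr2 hd (expected_missed_ge hd hn hr2 hrle)
  have hfac : (0 : ℝ) < Nat.factorial (n + m) := by exact_mod_cast Nat.factorial_pos _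
  rw [le_div_iff₀ (by positivity)]
  have hsum : ((Finset.univ.filter fun C : Fin n → Fin r =>
      (cands (d := d) C).Nonempty).card : ℝ) *
        ((d : ℝ) / r * (Nat.factorial (n + m) : ℝ) / 4) ≤
      ∑ C : Fin n → Fin r, ∑ π : Equiv.Perm (Fin (n + m)),
          ∑ hs : Fin k → (Dom r d → Bool),
            (∏ i : Fin k, wRand ((L i).map (sample (d := d) hr C π)) (hs i)) *
              (((Finset.univ.filter fun i : Fin r =>
                  vote hs (Sum.inl i) = true).card : ℝ) / (r : ℝ)) := by
    rw [← nsmul_eq_mul, ← Finset.sum_const]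
    exact (Finset.sum_le_sum fun C hC => expected_errors_ge hr hnpos ht hk hmul L hL C
      (Finset.mem_filter.1 hC).2).trans
      (Finset.sum_le_sum_of_subset_of_nonneg (Finset.subset_univ _)
        fun C _ _ => expected_errors_nonneg hr L C)
  refine le_trans ?_ hsum
  have hrate : (d : ℝ) * Real.log (n / d) / (9 * n) ≤ d / r := by
    have h9 : (r : ℝ) ≤ 9 * (n / Real.log (n / d)) := by linarith
    calc (d : ℝ) * Real.log (n / d) / (9 * n) = d / (9 * (n / Real.log (n / d))) := by
          field_simp
      _ ≤ d / r := by gcongr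
  have hrate' : (d : ℝ) * Real.log (n / d) / (100 * n) ≤ d / r * (9 / 100) :=
    calc (d : ℝ) * Real.log (n / d) / (100 * n)
        = (d : ℝ) * Real.log (n / d) / (9 * n) * (9 / 100) := by field_simp
      _ ≤ _ := by gcongr
  calc (d : ℝ) * Real.log (n / d) / (100 * n) * ((r : ℝ) ^ n * Nat.factorial (n + m))
      ≤ d / r * (9 / 100) * ((r : ℝ) ^ n * Nat.factorial (n + m)) := by gcongr
    _ ≤ d / r * (5 / 36) * ((r : ℝ) ^ n * Nat.factorial (n + m)) :=
        mul_le_mul_of_nonneg_right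
          (mul_le_mul_of_nonneg_left (by norm_num) (by positivity)) (by positivity)
    _ = 5 / 9 * (r : ℝ) ^ n * ((d : ℝ) / r * Nat.factorial (n + m) / 4) := by ring
    _ ≤ _ := by gcongr

end
end

section
/- Let d ≥ 1 and r ≥ d be integers, and let X be the disjoint union of {x_1,…,x_r}, {y_T : T ⊆ {1,…,r}, |T| = d}, and {z_1,…,z_1000}. Let H consist of the all-zero function together with, for each d-element subset T of {1,…,r} and each j ∈ {1,…,1000}, the function h_{T,j} given by: h_{T,j}(x_i) = 1 iff i ∈ T; h_{T,j}(y_{T'}) = 1 iff T' ≠ T; h_{T,j}(z_{j'}) = 1 iff j' = j. Then the VC dimension of H is at most d + 2. -/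
open Classical

/-- `H` shatters a finite set `A` if every boolean function on `A` agrees on `A` with
some member of `H`. -/
def Shatters {X : Type*} (H : Set (X → Bool)) (A : Finset X) : Prop :=
  ∀ f : X → Bool, ∃ h ∈ H, ∀ x ∈ A, h x = f x

/-- The hypothesis `h_{T,j}`: `h_{T,j}(x_i) = 1` iff `i ∈ T`; `h_{T,j}(y_{T'}) = 1` iff
`T' ≠ T`; `h_{T,j}(z_{j'}) = 1` iff `j' = j`. -/
def hTj {r d : ℕ} (T : {T : Finset (Fin r) // T.card = d}) (j : Fin 1000) :
    Dom r d → Bool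
  | Sum.inl i => decide (i ∈ T.1)
  | Sum.inr (Sum.inl T') => decide (T' ≠ T)
  | Sum.inr (Sum.inr j') => decide (j' = j)

/-- The class consisting of the all-zero function together with all the `h_{T,j}`. -/
def HTj (r d : ℕ) : Set (Dom r d → Bool) :=
  {f | f = (fun _ => false) ∨
    ∃ (T : {T : Finset (Fin r) // T.card = d}) (j : Fin 1000), f = hTj T j}

/-- A pattern with a one on a shattered set is realized by some `h_{T,j}`. -/
lemma Shatters.exists_hTj {r d : ℕ} {A : Finset (Dom r d)} (hA : Shatters (HTj r d) A)
    (f : Dom r d → Bool) {a : Dom r d} (ha : a ∈ A) (hfa : f a = true) :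
    ∃ T j, ∀ x ∈ A, hTj T j x = f x := by
  obtain ⟨h, rfl | ⟨T, j, rfl⟩, hf⟩ := hA f
  · simpa [hfa] using hf a ha
  · exact ⟨T, j, hf⟩

lemma Shatters.card_toLeft_le {r d : ℕ} {A : Finset (Dom r d)}
    (hA : Shatters (HTj r d) A) : A.toLeft.card ≤ d := by
  rcases A.toLeft.eq_empty_or_nonempty with h | ⟨i, hi⟩
  · simp [h]
  obtain ⟨T, j, hT⟩ := hA.exists_hTj (fun _ => true) (Finset.mem_toLeft.1 hi) rfl
  refine (Finset.card_le_card fun k hk => ?_).trans_eq T.2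
  simpa [hTj] using hT _ (Finset.mem_toLeft.1 hk)

lemma Shatters.card_toRight_toRight_le_one {r d : ℕ} {A : Finset (Dom r d)}
    (hA : Shatters (HTj r d) A) : A.toRight.toRight.card ≤ 1 := by
  refine Finset.card_le_one.2 fun a ha b hb => ?_
  rw [Finset.mem_toRight, Finset.mem_toRight] at ha hb
  obtain ⟨T, j, hT⟩ := hA.exists_hTj (fun _ => true) ha rfl
  have h₁ : a = j := by simpa [hTj] using hT _ ha
  have h₂ : b = j := by simpa [hTj] using hT _ hb
  rw [h₁, h₂]

lemma Shatters.card_toRight_toLeft_le_one {r d : ℕ} {A : Finset (Dom r d)}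
    (hA : Shatters (HTj r d) A) (hcard : 2 < A.card) : A.toRight.toLeft.card ≤ 1 := by
  refine Finset.card_le_one.2 fun S hS S' hS' => ?_
  rw [Finset.mem_toLeft, Finset.mem_toRight] at hS hS'
  let P : Finset (Dom r d) := {Sum.inr (Sum.inl S), Sum.inr (Sum.inl S')}
  obtain ⟨a, ha, haP⟩ := Finset.exists_mem_notMem_of_card_lt_card
    ((Finset.card_le_two : P.card ≤ 2).trans_lt hcard)
  obtain ⟨T, j, hT⟩ := hA.exists_hTj (fun x => decide (x ∉ P)) ha (decide_eq_true haP)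
  have h₁ : S = T := by simpa [hTj, P] using hT _ hS
  have h₂ : S' = T := by simpa [hTj, P] using hT _ hS'
  rw [h₁, h₂]

/-- for `d ≥ 1` and `r ≥ d`, the VC dimension of the class `HTj r d` is at
most `d + 2`, i.e. every shattered finite set has at most `d + 2` elements. -/
theorem vc_dim_hTj_le (d r : ℕ) (hd : 1 ≤ d) (hr : d ≤ r) :
    ∀ A : Finset (Dom r d), Shatters (HTj r d) A → A.card ≤ d + 2 := by
  intro A hA
  by_contra! hlt
  have hx := hA.card_toLeft_le
  have hy := hA.card_toRight_toLeft_le_one (by omega)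
  have hz := hA.card_toRight_toRight_le_one
  have h₁ := A.card_toLeft_add_card_toRight
  have h₂ := A.toRight.card_toLeft_add_card_toRight
  omega
end
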